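/- arXiv:2506.20173 — 8 statements merged into one kernel-verified Lean document; each statement's English description precedes it below -/
import Mathlib

section
/- Valid stable selection (Theorem 3.1). Let (Ω₀, 𝒜₀, ℙ₀) and (E, ℰ, ℙ_ε) be probability spaces and let ℙ = ℙ₀ ⊗ ℙ_ε be the product measure on Ω₀ × E. Let S and Ξ be measurable spaces, ξ : Ω₀ → Ξ measurable, Ŝ : Ξ × E → S measurable, and let A ⊆ S × Ω₀ be jointly measurable such that ℙ₀(A_s) ≤ α for every s ∈ S, where A_s = {ω₀ : (s, ω₀) ∈ A}. Suppose there exist η, τ, ν ≥ 0, a probability measure μ₀ on S, and a measurable set N ⊆ Ω₀ with ℙ₀(N) ≤ ν such that for every ω₀ ∉ N and every measurable set O ⊆ S one has ℙ_ε{e ∈ E : Ŝ(ξ(ω₀), e) ∈ O} ≤ e^η μ₀(O) + τ. Then ℙ{(ω₀, e) : (Ŝ(ξ(ω₀), e), ω₀) ∈ A} ≤ α·e^η + τ + ν. -/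
open MeasureTheory Real

/-- **Valid stable selection (Theorem 3.1).** If each confidence set indexed by `s ∈ S` has
miscoverage at most `α`, and the randomized selection `Shat` is `(η, τ, ν)`-stable (its
conditional law given the data is `(η, τ)`-indistinguishable from a fixed reference law `μ₀`,
outside an exceptional set `N` of probability at most `ν`), then the miscoverage probability
of the selected confidence set is at most `α·e^η + τ + ν`. -/
theorem valid_stable_selection
    {Ω₀ E S Ξ : Type*}
    [MeasurableSpace Ω₀] [MeasurableSpace E] [MeasurableSpace S] [MeasurableSpace Ξ]
    (P₀ : Measure Ω₀) (Pε : Measure E)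
    [IsProbabilityMeasure P₀] [IsProbabilityMeasure Pε]
    (ξ : Ω₀ → Ξ) (hξ : Measurable ξ)
    (Shat : Ξ × E → S) (hShat : Measurable Shat)
    (A : Set (S × Ω₀)) (hA : MeasurableSet A)
    (α η τ ν : ℝ) (hα : 0 ≤ α) (hη : 0 ≤ η) (hτ : 0 ≤ τ) (hν : 0 ≤ ν)
    (hcov : ∀ s : S, P₀ {ω₀ | (s, ω₀) ∈ A} ≤ ENNReal.ofReal α)
    (μ₀ : Measure S) [IsProbabilityMeasure μ₀]
    (N : Set Ω₀) (hN : MeasurableSet N) (hNν : P₀ N ≤ ENNReal.ofReal ν)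
    (hstable : ∀ ω₀ ∉ N, ∀ O : Set S, MeasurableSet O →
      Pε {e | Shat (ξ ω₀, e) ∈ O} ≤ ENNReal.ofReal (exp η) * μ₀ O + ENNReal.ofReal τ) :
    (P₀.prod Pε) {p : Ω₀ × E | (Shat (ξ p.1, p.2), p.1) ∈ A}
      ≤ ENNReal.ofReal (α * exp η + τ + ν) := by
  have hmeas : MeasurableSet {p : Ω₀ × E | (Shat (ξ p.1, p.2), p.1) ∈ A} :=
    ((hShat.comp ((hξ.comp measurable_fst).prodMk measurable_snd)).prodMk measurable_fst) hA
  have hslice : Measurable fun ω₀ => μ₀ {s | (s, ω₀) ∈ A} := measurable_measure_prodMk_right hA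
  have hpoint (ω₀ : Ω₀) : Pε {e | (Shat (ξ ω₀, e), ω₀) ∈ A} ≤
      ENNReal.ofReal (exp η) * μ₀ {s | (s, ω₀) ∈ A} + ENNReal.ofReal τ + N.indicator 1 ω₀ := by
    by_cases hω : ω₀ ∈ N
    · rw [Set.indicator_of_mem hω]
      exact prob_le_one.trans le_add_self
    · exact (hstable ω₀ hω {s | (s, ω₀) ∈ A} (measurable_prodMk_right hA)).trans le_self_add
  have hfubini : ∫⁻ ω₀, μ₀ {s | (s, ω₀) ∈ A} ∂P₀ ≤ ENNReal.ofReal α :=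
    calc ∫⁻ ω₀, μ₀ {s | (s, ω₀) ∈ A} ∂P₀
      _ = (μ₀.prod P₀) A := (Measure.prod_apply_symm hA).symm
      _ = ∫⁻ s, P₀ {ω₀ | (s, ω₀) ∈ A} ∂μ₀ := Measure.prod_apply hA
      _ ≤ ∫⁻ _, ENNReal.ofReal α ∂μ₀ := lintegral_mono hcov
      _ = ENNReal.ofReal α := by simp
  calc (P₀.prod Pε) {p : Ω₀ × E | (Shat (ξ p.1, p.2), p.1) ∈ A}
    _ = ∫⁻ ω₀, Pε {e | (Shat (ξ ω₀, e), ω₀) ∈ A} ∂P₀ := Measure.prod_apply hmeas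
    _ ≤ ∫⁻ ω₀, (ENNReal.ofReal (exp η) * μ₀ {s | (s, ω₀) ∈ A} + ENNReal.ofReal τ
          + N.indicator 1 ω₀) ∂P₀ := lintegral_mono hpoint
    _ = ENNReal.ofReal (exp η) * ∫⁻ ω₀, μ₀ {s | (s, ω₀) ∈ A} ∂P₀ + ENNReal.ofReal τ + P₀ N := by
      rw [lintegral_add_left ((hslice.const_mul _).add_const _),
        lintegral_add_right _ measurable_const, lintegral_const_mul _ hslice, lintegral_const,
        measure_univ, mul_one, lintegral_indicator_one hN]
    _ ≤ ENNReal.ofReal (exp η) * ENNReal.ofReal α + ENNReal.ofReal τ + ENNReal.ofReal ν := by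
      gcongr
    _ = ENNReal.ofReal (α * exp η + τ + ν) := by
      rw [ENNReal.ofReal_add (by positivity) hν, ENNReal.ofReal_add (by positivity) hτ,
        ENNReal.ofReal_mul hα, mul_comm]
end

section
/- Smallest conformal set selection (Corollary 3.2). Let (Ω, ℱ, ℙ) be a probability space, K ≥ 1, α ∈ (0,1), η, τ ≥ 0, and let A_1, …, A_K be events with ℙ(A_i) ≤ α for every i ∈ {1,…,K}. Let p : Ω → Δ^{K−1} be measurable and suppose there exists b ∈ Δ^{K−1} such that for every ω ∈ Ω and every subset G ⊆ {1,…,K}, Σ_{i∈G} p_i(ω) ≤ e^η Σ_{i∈G} b_i + τ. Then E[Σ_{i=1}^K p_i·1_{A_i}] ≤ α·e^η + τ; equivalently, 1 − E[Σ_{i=1}^K p_i·1_{A_i}] ≥ 1 − α·e^η − τ. -/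
open MeasureTheory Real

/-- Integrating a stability bound that holds for all index sets, applied pointwise to the set of
indices whose event occurs. -/
theorem integral_sum_mul_indicator_le {Ω ι : Type*} [MeasurableSpace Ω] [Fintype ι]
    (P : Measure Ω) [IsProbabilityMeasure P] (α η τ : ℝ)
    (A : ι → Set Ω) (hAmeas : ∀ i, MeasurableSet (A i)) (hA : ∀ i, P.real (A i) ≤ α)
    (p : Ω → ι → ℝ) (hp : ∀ ω i, 0 ≤ p ω i) (b : ι → ℝ) (hb : b ∈ stdSimplex ℝ ι)
    (hstab : ∀ ω, ∀ G : Finset ι, ∑ i ∈ G, p ω i ≤ exp η * ∑ i ∈ G, b i + τ) :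
    ∫ ω, (∑ i, p ω i * (A i).indicator (fun _ => (1:ℝ)) ω) ∂P ≤ α * exp η + τ := by
  classical
  have h_int : ∀ i, Integrable (fun ω => b i * (A i).indicator (fun _ => (1:ℝ)) ω) P := fun i =>
    ((integrable_const (1:ℝ)).indicator (hAmeas i)).const_mul (b i)
  have h_sum_int : Integrable
      (fun ω => exp η * ∑ i, b i * (A i).indicator (fun _ => (1:ℝ)) ω) P :=
    (integrable_finsetSum _ fun i _ => h_int i).const_mul _
  have h_filter : ∀ (q : ι → ℝ) (ω : Ω),
      ∑ i, q i * (A i).indicator (fun _ => (1:ℝ)) ω = ∑ i with ω ∈ A i, q i := fun q ω => by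
    simp [Finset.sum_filter, Set.indicator_apply]
  calc ∫ ω, (∑ i, p ω i * (A i).indicator (fun _ => (1:ℝ)) ω) ∂P
      ≤ ∫ ω, (exp η * ∑ i, b i * (A i).indicator (fun _ => (1:ℝ)) ω + τ) ∂P := by
        refine integral_mono_of_nonneg (ae_of_all _ fun ω => ?_)
          (h_sum_int.add (integrable_const τ)) (ae_of_all _ fun ω => ?_)
        · exact Finset.sum_nonneg fun i _ =>
            mul_nonneg (hp ω i) (Set.indicator_nonneg (fun _ _ => zero_le_one) ω)
        · simpa only [h_filter] using hstab ω _
    _ = exp η * ∑ i, b i * P.real (A i) + τ := by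
        rw [integral_add h_sum_int (integrable_const τ), integral_const_mul,
          integral_finsetSum _ fun i _ => h_int i]
        simp [integral_const_mul, integral_indicator_const, hAmeas]
    _ ≤ exp η * ∑ i, b i * α + τ := by
        gcongr with i
        · exact hb.1 i
        · exact hA i
    _ = α * exp η + τ := by rw [← Finset.sum_mul, hb.2]; ring

/-- **Smallest conformal set selection (Corollary 3.2).** If each miscoverage event `A i`
has probability at most `α`, and the conditional selection distribution `p ω ∈ Δ^{K-1}`
satisfies the `(η,τ)`-stability bound with respect to a prior `b ∈ Δ^{K-1}`, then the
miscoverage probability of the selected set, `E[∑ i, p i · 1_{A i}]`, is at most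
`α·e^η + τ`; equivalently the coverage is at least `1 - α·e^η - τ`. -/
theorem smallest_conformal_set_selection
    {Ω : Type*} [MeasurableSpace Ω] (P : Measure Ω) [IsProbabilityMeasure P]
    (K : ℕ) (hK : 1 ≤ K) (α η τ : ℝ) (hα : α ∈ Set.Ioo (0:ℝ) 1) (hη : 0 ≤ η) (hτ : 0 ≤ τ)
    (A : Fin K → Set Ω) (hAmeas : ∀ i, MeasurableSet (A i))
    (hA : ∀ i, P (A i) ≤ ENNReal.ofReal α)
    (p : Ω → Fin K → ℝ) (hp : Measurable p)
    (hpsimplex : ∀ ω, p ω ∈ stdSimplex ℝ (Fin K))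
    (b : Fin K → ℝ) (hb : b ∈ stdSimplex ℝ (Fin K))
    (hstab : ∀ ω, ∀ G : Finset (Fin K), ∑ i ∈ G, p ω i ≤ exp η * ∑ i ∈ G, b i + τ) :
    (∫ ω, (∑ i, p ω i * (A i).indicator (fun _ => (1:ℝ)) ω) ∂P ≤ α * exp η + τ)
    ∧ 1 - α * exp η - τ ≤ 1 - ∫ ω, (∑ i, p ω i * (A i).indicator (fun _ => (1:ℝ)) ω) ∂P := by
  have h_le := integral_sum_mul_indicator_le P α η τ A hAmeas
    (fun i => ENNReal.toReal_le_of_le_ofReal hα.1.le (hA i)) p (fun ω i => (hpsimplex ω).1 i)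
    b hb hstab
  exact ⟨h_le, by linarith⟩
end

section
/- Stability via Laplace noise (Lemma 3.3). Fix η > 0 and let μ_η be the probability measure on ℝ with density x ↦ (η/2)·exp(−η|x|) with respect to Lebesgue measure (the Laplace distribution with scale 1/η). Let ε_1, …, ε_K be i.i.d. random variables with law μ_η and let λ_1, …, λ_K ∈ [0,1] be fixed constants. Then for every i ∈ {1,…,K}: ℙ{λ_i + ε_i ≤ λ_j + ε_j for all j ≠ i} ≤ e^η · ℙ{ε_i ≤ ε_j for all j ≠ i}. Consequently, the selection Ŝ = argmin_{i∈{1,…,K}} (λ_i + ε_i) satisfies ℙ{Ŝ = i} ≤ e^η·ℙ{S₀ = i} for all i, where S₀ = argmin_{i∈{1,…,K}} ε_i (both argmins are almost surely unique). -/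
open MeasureTheory Real

/-- Translating a measure with density `c * exp (-η * |x|)` by `a` multiplies the mass of a set by
at most `exp (η * |a|)`. -/
theorem withDensity_laplace_preimage_sub_le {c η : ℝ} (hc : 0 ≤ c) (hη : 0 ≤ η) (a : ℝ)
    {T : Set ℝ} (hT : MeasurableSet T) :
    volume.withDensity (fun x => ENNReal.ofReal (c * exp (-η * |x|))) ((fun x => x - a) ⁻¹' T)
      ≤ ENNReal.ofReal (exp (η * |a|)) *
        volume.withDensity (fun x => ENNReal.ofReal (c * exp (-η * |x|))) T := by
  have hpre : MeasurableSet ((fun x : ℝ => x - a) ⁻¹' T) := (measurable_sub_const a) hT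
  rw [withDensity_apply _ hpre, withDensity_apply _ hT]
  have hdens : Measurable fun y : ℝ => ENNReal.ofReal (c * exp (-η * |y|)) := by fun_prop
  have hshift : Measurable fun y : ℝ => ENNReal.ofReal (c * exp (-η * |y + a|)) := by fun_prop
  have key := (measurePreserving_sub_right volume a).setLIntegral_comp_preimage hT hshift
  simp only [sub_add_cancel] at key
  rw [key, ← lintegral_const_mul _ hdens]
  refine lintegral_mono fun y => ?_
  rw [← ENNReal.ofReal_mul (exp_pos _).le]
  refine ENNReal.ofReal_le_ofReal ?_
  rw [mul_left_comm, ← Real.exp_add]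
  have htri : |y| ≤ |y + a| + |a| := by simpa using abs_sub (y + a) a
  gcongr
  nlinarith [mul_le_mul_of_nonneg_left htri hη]

/-- If, for every value of the remaining coordinates, the `i`-th section of `A` has mass at most
`c` times that of the `i`-th section of `B`, then the same comparison holds for `A` and `B`. -/
theorem measure_pi_le_mul_of_sections_le {n : ℕ} (μ : Measure ℝ) [SigmaFinite μ]
    (i : Fin (n + 1)) {c : ENNReal} {A B : Set (Fin (n + 1) → ℝ)}
    (hA : MeasurableSet A) (hB : MeasurableSet B)
    (h : ∀ y : Fin n → ℝ, μ {x | i.insertNth x y ∈ A} ≤ c * μ {x | i.insertNth x y ∈ B}) :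
    Measure.pi (fun _ => μ) A ≤ c * Measure.pi (fun _ => μ) B := by
  have hmp := (measurePreserving_piFinSuccAbove (fun _ : Fin (n + 1) => μ) i).symm
  rw [← hmp.measure_preimage hA.nullMeasurableSet, ← hmp.measure_preimage hB.nullMeasurableSet,
    Measure.prod_apply_symm (hmp.measurable hA), Measure.prod_apply_symm (hmp.measurable hB),
    ← lintegral_const_mul _ (measurable_measure_prodMk_right (hmp.measurable hB))]
  exact lintegral_mono h

/-- **Stability via Laplace noise (Lemma 3.3).** Let `π` be the joint law of `K` i.i.d.
Laplace(scale `1/η`) random variables `ε₁, …, ε_K` and let `λ₁, …, λ_K ∈ [0,1]` be fixed.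
Then for every `i`, the probability that `i` is the argmin of `j ↦ λⱼ + εⱼ` is at most
`e^η` times the probability that `i` is the argmin of `j ↦ εⱼ`; i.e. the noisy-argmin
selection `Ŝ` is `η`-stable with reference variable `S₀ = argmin εⱼ`. -/
theorem stability_via_laplace_noise
    (K : ℕ) (hK : 1 ≤ K) (η : ℝ) (hη : 0 < η)
    (lam : Fin K → ℝ) (hlam : ∀ i, lam i ∈ Set.Icc (0:ℝ) 1)
    (μη : Measure ℝ)
    (hμη : μη = volume.withDensity (fun x => ENNReal.ofReal (η / 2 * exp (-η * |x|))))
    (μK : Measure (Fin K → ℝ)) (hμK : μK = Measure.pi (fun _ => μη))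
    (i : Fin K) :
    μK {e | ∀ j, j ≠ i → lam i + e i ≤ lam j + e j}
      ≤ ENNReal.ofReal (exp η) * μK {e | ∀ j, j ≠ i → e i ≤ e j} := by
  subst hμη hμK
  obtain ⟨n, rfl⟩ : ∃ n, K = n + 1 := ⟨K - 1, by omega⟩
  refine measure_pi_le_mul_of_sections_le _ i (by measurability) (by measurability) fun y => ?_
  have hT : MeasurableSet {x : ℝ | ∀ k, x ≤ y k} := by measurability
  have hshift := withDensity_laplace_preimage_sub_le (half_pos hη).le hη.le 1 hT
  rw [abs_one, mul_one] at hshift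
  refine (measure_mono fun x hx k => ?_).trans (hshift.trans ?_)
  · have hk := hx (i.succAbove k) (i.succAbove_ne k)
    simp only [Fin.insertNth_apply_same, Fin.insertNth_apply_succAbove] at hk
    linarith [(hlam i).1, (hlam (i.succAbove k)).2]
  · gcongr
    intro hx j hj
    obtain ⟨k, rfl⟩ := Fin.exists_succAbove_eq hj
    simpa using hx k
end

section
/- Optimality of MinSE (Proposition 3.6). Let η, τ ≥ 0, K ≥ 1, b ∈ Δ^{K−1}, and λ ∈ ℝ^K. Let F(b) = {q ∈ Δ^{K−1} : ∃ s ∈ ℝ^K, s_i ≥ 0 for all i, q_i ≤ e^η·b_i + s_i for all i, Σ_{i=1}^K s_i ≤ τ} denote the MinSE feasible set; F(b) is nonempty (it contains b) and compact, so the minimum of q ↦ Σ_{i=1}^K q_i λ_i over F(b) is attained. If p ∈ Δ^{K−1} satisfies Σ_{i∈G} p_i ≤ e^η Σ_{i∈G} b_i + τ for every subset G ⊆ {1,…,K}, then min_{q ∈ F(b)} Σ_{i=1}^K q_i λ_i ≤ Σ_{i=1}^K p_i λ_i. Consequently, for any (η, τ)-stable selection algorithm with reference distribution b, the MinSE solution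 with prior b achieves expected selected size no larger than that of the algorithm, almost surely over the input. -/
open Real

/-- The feasible set of the MinSE linear program with prior `b` and parameters `(η, τ)`. -/
def minseFeasible (K : ℕ) (η τ : ℝ) (b : Fin K → ℝ) : Set (Fin K → ℝ) :=
  {q | q ∈ stdSimplex ℝ (Fin K) ∧
    ∃ s : Fin K → ℝ, (∀ i, 0 ≤ s i) ∧ (∀ i, q i ≤ Real.exp η * b i + s i) ∧ ∑ i, s i ≤ τ}

/-- Feasibility for the MinSE program, with the slack variables eliminated. -/
theorem mem_minseFeasible_iff {K : ℕ} {η τ : ℝ} {b q : Fin K → ℝ} :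
    q ∈ minseFeasible K η τ b ↔
      q ∈ stdSimplex ℝ (Fin K) ∧ ∑ i, max (q i - Real.exp η * b i) 0 ≤ τ := by
  refine and_congr_right fun _ => ⟨?_, fun h => ?_⟩
  · rintro ⟨s, hs, hq, hτ⟩
    refine (Finset.sum_le_sum fun i _ => max_le ?_ (hs i)).trans hτ
    linarith [hq i]
  · exact ⟨_, fun i => le_max_right _ _,
      fun i => by linarith [le_max_left (q i - Real.exp η * b i) 0], h⟩

theorem isCompact_minseFeasible (K : ℕ) (η τ : ℝ) (b : Fin K → ℝ) :
    IsCompact (minseFeasible K η τ b) := by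
  have hset : minseFeasible K η τ b =
      stdSimplex ℝ (Fin K) ∩ {q | ∑ i, max (q i - Real.exp η * b i) 0 ≤ τ} :=
    Set.ext fun _ => mem_minseFeasible_iff
  rw [hset]
  exact (isCompact_stdSimplex ℝ (Fin K)).inter_right (isClosed_le (by fun_prop) continuous_const)

theorem self_mem_minseFeasible {K : ℕ} {η τ : ℝ} (hη : 0 ≤ η) (hτ : 0 ≤ τ) {b : Fin K → ℝ}
    (hb : b ∈ stdSimplex ℝ (Fin K)) : b ∈ minseFeasible K η τ b := by
  refine ⟨hb, 0, fun _ => le_rfl, fun i => ?_, by simpa using hτ⟩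
  simpa using le_mul_of_one_le_left (hb.1 i) (Real.one_le_exp hη)

/-- The stability bound on the set where `p i` exceeds `exp η * b i` gives feasibility. -/
theorem mem_minseFeasible_of_forall_sum_le {K : ℕ} {η τ : ℝ} {b p : Fin K → ℝ}
    (hp : p ∈ stdSimplex ℝ (Fin K))
    (h : ∀ G : Finset (Fin K), ∑ i ∈ G, p i ≤ Real.exp η * ∑ i ∈ G, b i + τ) :
    p ∈ minseFeasible K η τ b := by
  refine mem_minseFeasible_iff.2 ⟨hp, ?_⟩
  have hsum : ∑ i, max (p i - Real.exp η * b i) 0 =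
      ∑ i with 0 ≤ p i - Real.exp η * b i, (p i - Real.exp η * b i) := by
    rw [Finset.sum_filter]
    refine Finset.sum_congr rfl fun i _ => ?_
    split_ifs with hi
    · exact max_eq_left hi
    · exact max_eq_right (not_le.1 hi).le
  rw [hsum, Finset.sum_sub_distrib, ← Finset.mul_sum]
  linarith [h {i | 0 ≤ p i - Real.exp η * b i}]

/-- **Optimality of MinSE (Proposition 3.6).** The MinSE feasible set is nonempty
(it contains `b`) and compact, hence the minimum of `q ↦ ∑ i, q i·λ i` over it is
attained; moreover, for every `p ∈ Δ^{K-1}` satisfying the `(η,τ)`-stability bound with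
respect to `b`, the attained minimum is at most `∑ i, p i·λ i`. Consequently the MinSE
solution achieves expected selected size no larger than any `(η,τ)`-stable selection. -/
theorem minse_optimality
    (K : ℕ) (hK : 1 ≤ K) (η τ : ℝ) (hη : 0 ≤ η) (hτ : 0 ≤ τ)
    (b : Fin K → ℝ) (hb : b ∈ stdSimplex ℝ (Fin K))
    (lam : Fin K → ℝ) :
    b ∈ minseFeasible K η τ b
    ∧ IsCompact (minseFeasible K η τ b)
    ∧ ∃ q ∈ minseFeasible K η τ b,
        (∀ r ∈ minseFeasible K η τ b, ∑ i, q i * lam i ≤ ∑ i, r i * lam i)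
        ∧ ∀ p ∈ stdSimplex ℝ (Fin K),
            (∀ G : Finset (Fin K), ∑ i ∈ G, p i ≤ exp η * ∑ i ∈ G, b i + τ) →
            ∑ i, q i * lam i ≤ ∑ i, p i * lam i := by
  have hmem := self_mem_minseFeasible hη hτ hb
  have hcpt := isCompact_minseFeasible K η τ b
  obtain ⟨q, hq, hmin⟩ := hcpt.exists_isMinOn (f := fun q => ∑ i, q i * lam i) ⟨b, hmem⟩
    (by fun_prop)
  exact ⟨hmem, hcpt, q, hq, fun r hr => hmin hr,
    fun p hp hG => hmin (mem_minseFeasible_of_forall_sum_le hp hG)⟩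
end

section
/- Derandomized smallest conformal set (Proposition on derandomization). Let (Ω, ℱ, ℙ) be a probability space, K ≥ 1, α ∈ (0,1), η, τ ≥ 0, and let A_1, …, A_K be events with ℙ(A_i) ≤ α for every i. Let p : Ω → Δ^{K−1} be measurable and b ∈ Δ^{K−1} be such that for every ω ∈ Ω and every subset G ⊆ {1,…,K}, Σ_{i∈G} p_i(ω) ≤ e^η Σ_{i∈G} b_i + τ. Then ℙ{ω : Σ_{i=1}^K p_i(ω)·1_{A_i}(ω) ≥ 1/2} ≤ 2(α·e^η + τ). -/
open MeasureTheory Real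

/-- **Derandomized smallest conformal set.** If each miscoverage event `A i` has probability
at most `α`, and the conditional selection distribution `p ω ∈ Δ^{K-1}` satisfies the
`(η,τ)`-stability bound with respect to a prior `b`, then the probability that the
`p`-weighted fraction of miscovering sets reaches `1/2` is at most `2(α·e^η + τ)`;
this bounds the miscoverage of the derandomized (majority-vote) set `C_dr`. -/
theorem derandomized_smallest_conformal_set
    {Ω : Type*} [MeasurableSpace Ω] (P : Measure Ω) [IsProbabilityMeasure P]
    (K : ℕ) (hK : 1 ≤ K) (α η τ : ℝ) (hα : α ∈ Set.Ioo (0:ℝ) 1) (hη : 0 ≤ η) (hτ : 0 ≤ τ)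
    (A : Fin K → Set Ω) (hAmeas : ∀ i, MeasurableSet (A i))
    (hA : ∀ i, P (A i) ≤ ENNReal.ofReal α)
    (p : Ω → Fin K → ℝ) (hp : Measurable p)
    (hpsimplex : ∀ ω, p ω ∈ stdSimplex ℝ (Fin K))
    (b : Fin K → ℝ) (hb : b ∈ stdSimplex ℝ (Fin K))
    (hstab : ∀ ω, ∀ G : Finset (Fin K), ∑ i ∈ G, p ω i ≤ exp η * ∑ i ∈ G, b i + τ) :
    P {ω | (1:ℝ)/2 ≤ ∑ i, p ω i * (A i).indicator (fun _ => (1:ℝ)) ω}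
      ≤ ENNReal.ofReal (2 * (α * exp η + τ)) := by
  set g : Ω → ℝ := fun ω => exp η * ∑ i, b i * (A i).indicator (fun _ => (1:ℝ)) ω + τ with hg
  have hind : ∀ i, Integrable ((A i).indicator (fun _ => (1:ℝ))) P := fun i =>
    (integrable_const 1).indicator (hAmeas i)
  have hsum : Integrable (fun ω => ∑ i, b i * (A i).indicator (fun _ => (1:ℝ)) ω) P :=
    integrable_finsetSum _ fun i _ => (hind i).const_mul (b i)
  have hgint : Integrable g P := (hsum.const_mul _).add (integrable_const τ)
  have hg_nonneg : ∀ ω, 0 ≤ g ω := fun ω =>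
    add_nonneg (mul_nonneg (exp_pos η).le (Finset.sum_nonneg fun i _ =>
      mul_nonneg (hb.1 i) (Set.indicator_nonneg (fun _ _ => zero_le_one) ω))) hτ
  have hle : ∀ ω, ∑ i, p ω i * (A i).indicator (fun _ => (1:ℝ)) ω ≤ g ω := by
    intro ω
    classical
    have h := hstab ω {i | ω ∈ A i}
    simpa [hg, Set.indicator_apply, Finset.sum_filter] using h
  have hAreal : ∀ i, P.real (A i) ≤ α := fun i =>
    ENNReal.toReal_le_of_le_ofReal hα.1.le (hA i)
  have hgα : ∫ ω, g ω ∂P ≤ α * exp η + τ := by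
    have hb_sum : ∑ i, b i * P.real (A i) ≤ α := by
      calc ∑ i, b i * P.real (A i) ≤ ∑ i, b i * α :=
            Finset.sum_le_sum fun i _ => mul_le_mul_of_nonneg_left (hAreal i) (hb.1 i)
        _ = α := by rw [← Finset.sum_mul, hb.2, one_mul]
    have hg_eq : ∫ ω, g ω ∂P = exp η * ∑ i, b i * P.real (A i) + τ := by
      rw [hg, integral_add (hsum.const_mul _) (integrable_const τ), integral_const_mul,
        integral_finsetSum _ fun i _ => (hind i).const_mul (b i)]
      simp [integral_const_mul, integral_indicator, hAmeas]
    rw [hg_eq, mul_comm α]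
    gcongr
  have hmarkov := mul_meas_ge_le_integral_of_nonneg (Filter.Eventually.of_forall hg_nonneg) hgint
    (1 / 2)
  calc P {ω | (1:ℝ)/2 ≤ ∑ i, p ω i * (A i).indicator (fun _ => (1:ℝ)) ω}
      ≤ P {ω | (1:ℝ)/2 ≤ g ω} := measure_mono fun ω hω => le_trans hω (hle ω)
    _ = ENNReal.ofReal (P.real {ω | (1:ℝ)/2 ≤ g ω}) := (ofReal_measureReal).symm
    _ ≤ ENNReal.ofReal (2 * (α * exp η + τ)) := ENNReal.ofReal_le_ofReal (by linarith)
end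

section
/- Smallest online conformal set selection (Corollary 4.1). Let α ∈ (0,1), η, τ ≥ 0, K ≥ 1, and b ∈ Δ^{K−1}. For every t ∈ ℕ and i ∈ {1,…,K}, let a_{t,i} ∈ {0,1}, and assume that for every i: liminf_{T→∞} (1/T) Σ_{t=1}^T (1 − a_{t,i}) ≥ 1 − α. For every t let p_t ∈ Δ^{K−1} satisfy, for every subset G ⊆ {1,…,K}, Σ_{i∈G} p_{t,i} ≤ e^η Σ_{i∈G} b_i + τ. Then liminf_{T→∞} (1/T) Σ_{t=1}^T (1 − Σ_{i=1}^K p_{t,i}·a_{t,i}) ≥ 1 − α·e^η − τ. -/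
open Real Filter

/-- The stability bound on sets extends to indicator-valued test vectors. -/
lemma sum_mul_le_of_forall_sum_le {ι : Type*} [Fintype ι] {p b a : ι → ℝ} {c τ : ℝ}
    (ha : ∀ i, a i = 0 ∨ a i = 1)
    (h : ∀ G : Finset ι, ∑ i ∈ G, p i ≤ c * ∑ i ∈ G, b i + τ) :
    ∑ i, p i * a i ≤ c * ∑ i, b i * a i + τ := by
  classical
  have key (q : ι → ℝ) : ∑ i, q i * a i = ∑ i with a i = 1, q i := by
    rw [Finset.sum_filter]
    refine Finset.sum_congr rfl fun i _ => ?_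
    rcases ha i with h | h <;> simp [h]
  rw [key, key]
  exact h _

/-- Lower bound on the running average of the selected coverage by the prior-weighted running
averages of the individual coverages. -/
lemma average_selected_coverage_ge {ι : Type*} [Fintype ι] {b : ι → ℝ} {a p : ℕ → ι → ℝ}
    {c τ : ℝ} (hb : ∑ i, b i = 1)
    (h : ∀ t, ∑ i, p t i * a t i ≤ c * ∑ i, b i * a t i + τ) {T : ℕ} (hT : 0 < T) :
    1 - τ - c + c * ∑ i, b i * ((1 / (T : ℝ)) * ∑ t ∈ Finset.range T, (1 - a t i)) ≤
      (1 / (T : ℝ)) * ∑ t ∈ Finset.range T, (1 - ∑ i, p t i * a t i) := by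
  have hT' : (0 : ℝ) < T := by exact_mod_cast hT
  have hswap : ∑ i, b i * ((1 / (T : ℝ)) * ∑ t ∈ Finset.range T, (1 - a t i)) =
      (1 / (T : ℝ)) * ∑ t ∈ Finset.range T, (1 - ∑ i, b i * a t i) := by
    simp_rw [← hb, ← Finset.sum_sub_distrib, Finset.mul_sum]
    rw [Finset.sum_comm]
    refine Finset.sum_congr rfl fun t _ => Finset.sum_congr rfl fun i _ => ?_
    rw [hb]
    ring
  have hsum : ∑ t ∈ Finset.range T, (1 - τ - c + c * (1 - ∑ i, b i * a t i)) ≤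
      ∑ t ∈ Finset.range T, (1 - ∑ i, p t i * a t i) :=
    Finset.sum_le_sum fun t _ => by linarith [h t]
  rw [hswap]
  calc _ = (1 / (T : ℝ)) * ∑ t ∈ Finset.range T, (1 - τ - c + c * (1 - ∑ i, b i * a t i)) := by
        rw [Finset.sum_add_distrib, ← Finset.mul_sum, Finset.sum_const, Finset.card_range,
          nsmul_eq_mul]
        field_simp
    _ ≤ _ := mul_le_mul_of_nonneg_left hsum (by positivity)

/-- Running averages of a sequence bounded above by `1` are at most `1`. -/
lemma average_le_one {f : ℕ → ℝ} (hf : ∀ t, f t ≤ 1) (T : ℕ) :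
    (1 / (T : ℝ)) * ∑ t ∈ Finset.range T, f t ≤ 1 := by
  have h : ∑ t ∈ Finset.range T, f t ≤ T := by
    simpa using Finset.sum_le_sum fun t (_ : t ∈ Finset.range T) => hf t
  rw [one_div, inv_mul_eq_div]
  exact div_le_one_of_le₀ h T.cast_nonneg

/-- **Smallest online conformal set selection (Corollary 4.1).** Let `a t i ∈ {0,1}` be the
miscoverage indicator of the `i`-th online conformal predictor at time `t`, and assume each
predictor achieves asymptotic coverage `1 - α`. If at each time `t` the selection
distribution `p t ∈ Δ^{K-1}` satisfies the `(η,τ)`-stability bound with respect to a fixed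
prior `b`, then the selected predictor achieves asymptotic coverage `1 - α·e^η - τ`. -/
theorem smallest_online_conformal_set_selection
    (K : ℕ) (hK : 1 ≤ K) (α η τ : ℝ) (hα : α ∈ Set.Ioo (0:ℝ) 1) (hη : 0 ≤ η) (hτ : 0 ≤ τ)
    (b : Fin K → ℝ) (hb : b ∈ stdSimplex ℝ (Fin K))
    (a : ℕ → Fin K → ℝ) (ha : ∀ t i, a t i = 0 ∨ a t i = 1)
    (hcov : ∀ i, (1 - α) ≤
      liminf (fun T : ℕ => (1/(T:ℝ)) * ∑ t ∈ Finset.range T, (1 - a t i)) atTop)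
    (p : ℕ → Fin K → ℝ) (hp : ∀ t, p t ∈ stdSimplex ℝ (Fin K))
    (hstab : ∀ t, ∀ G : Finset (Fin K), ∑ i ∈ G, p t i ≤ exp η * ∑ i ∈ G, b i + τ) :
    1 - α * exp η - τ ≤
      liminf (fun T : ℕ =>
        (1/(T:ℝ)) * ∑ t ∈ Finset.range T, (1 - ∑ i, p t i * a t i)) atTop := by
  have ha0 t i : 0 ≤ a t i := by rcases ha t i with h | h <;> simp [h]
  have ha1 t i : a t i ≤ 1 := by rcases ha t i with h | h <;> simp [h]
  refine le_of_forall_sub_le fun ε hε => ?_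
  have hδ : 0 < ε / exp η := by positivity
  refine le_liminf_of_le ?_ ?_
  · refine isCoboundedUnder_ge_of_le atTop (x := 1) fun T => average_le_one (fun t => ?_) T
    exact sub_le_self _ (Finset.sum_nonneg fun i _ => mul_nonneg ((hp t).1 i) (ha0 t i))
  have hev : ∀ᶠ T : ℕ in atTop, ∀ i,
      1 - α - ε / exp η < (1 / (T : ℝ)) * ∑ t ∈ Finset.range T, (1 - a t i) := by
    refine eventually_all.2 fun i =>
      eventually_lt_of_lt_liminf (lt_of_lt_of_le (by linarith) (hcov i)) ?_
    refine isBoundedUnder_of ⟨0, fun T => ?_⟩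
    exact mul_nonneg (by positivity) (Finset.sum_nonneg fun t _ => sub_nonneg.2 (ha1 t i))
  filter_upwards [hev, eventually_gt_atTop 0] with T hT hpos
  refine le_trans ?_ (average_selected_coverage_ge hb.2
    (fun t => sum_mul_le_of_forall_sum_le (ha t) (hstab t)) hpos)
  have hw : 1 - α - ε / exp η ≤
      ∑ i, b i * ((1 / (T : ℝ)) * ∑ t ∈ Finset.range T, (1 - a t i)) := by
    calc 1 - α - ε / exp η = ∑ i, b i * (1 - α - ε / exp η) := by
          rw [← Finset.sum_mul, hb.2, one_mul]
      _ ≤ _ := Finset.sum_le_sum fun i _ => mul_le_mul_of_nonneg_left (hT i).le (hb.1 i)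
  have hmul := mul_le_mul_of_nonneg_left hw (exp_pos η).le
  have hcancel : exp η * (ε / exp η) = ε := mul_div_cancel₀ ε (exp_pos η).ne'
  linarith
end

section
/- Adaptive COMA, combined-set coverage (Proposition 4.2(i)). Let (Ω, ℱ, ℙ) be a probability space, K ≥ 1, η, τ ≥ 0, let A_1, …, A_K be events, let w : Ω → Δ^{K−1} be measurable, and set β = E[Σ_{i=1}^K w_i·1_{A_i}]. Let p : Ω → Δ^{K−1} be measurable such that for every ω ∈ Ω and every subset G ⊆ {1,…,K}, Σ_{i∈G} p_i(ω) ≤ e^η Σ_{i∈G} w_i(ω) + τ. Then ℙ{ω : Σ_{i=1}^K p_i(ω)·1_{A_i}(ω) ≥ 1/2} ≤ 2(β·e^η + τ). -/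
open MeasureTheory Real

/-- A stability bound on all subsets transfers to sums weighted by set indicators. -/
lemma sum_mul_indicator_le_of_forall_finset {Ω ι : Type*} [Fintype ι] (A : ι → Set Ω) (ω : Ω)
    (p w : ι → ℝ) (c τ : ℝ) (h : ∀ G : Finset ι, ∑ i ∈ G, p i ≤ c * ∑ i ∈ G, w i + τ) :
    ∑ i, p i * (A i).indicator (fun _ => (1:ℝ)) ω
      ≤ c * ∑ i, w i * (A i).indicator (fun _ => (1:ℝ)) ω + τ := by
  classical
  have key (q : ι → ℝ) : ∑ i, q i * (A i).indicator (fun _ => (1:ℝ)) ω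
      = ∑ i with ω ∈ A i, q i := by
    simp [Finset.sum_filter, Set.indicator_apply]
  simpa only [key] using h _

/-- **Adaptive COMA, combined-set coverage (Proposition 4.2(i)).** Let `w ω ∈ Δ^{K-1}` be the
(data-dependent) COMA weights, `A i` the miscoverage events, and
`β = E[∑ i, w i · 1_{A i}]`. If the MinSE output `p ω` satisfies the pointwise
`(η,τ)`-stability bound with respect to the prior `w ω`, then the probability that the
`p`-weighted fraction of miscovering sets reaches `1/2` (i.e. that the combined
majority-vote set miscovers) is at most `2(β·e^η + τ)`. -/
theorem adaptive_coma_combined_set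
    {Ω : Type*} [MeasurableSpace Ω] (P : Measure Ω) [IsProbabilityMeasure P]
    (K : ℕ) (hK : 1 ≤ K) (η τ : ℝ) (hη : 0 ≤ η) (hτ : 0 ≤ τ)
    (A : Fin K → Set Ω) (hAmeas : ∀ i, MeasurableSet (A i))
    (w : Ω → Fin K → ℝ) (hw : Measurable w)
    (hwsimplex : ∀ ω, w ω ∈ stdSimplex ℝ (Fin K))
    (β : ℝ) (hβ : β = ∫ ω, (∑ i, w ω i * (A i).indicator (fun _ => (1:ℝ)) ω) ∂P)
    (p : Ω → Fin K → ℝ) (hp : Measurable p)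
    (hpsimplex : ∀ ω, p ω ∈ stdSimplex ℝ (Fin K))
    (hstab : ∀ ω, ∀ G : Finset (Fin K), ∑ i ∈ G, p ω i ≤ exp η * ∑ i ∈ G, w ω i + τ) :
    P {ω | (1:ℝ)/2 ≤ ∑ i, p ω i * (A i).indicator (fun _ => (1:ℝ)) ω}
      ≤ ENNReal.ofReal (2 * (β * exp η + τ)) := by
  have hint : Integrable (fun ω => ∑ i, w ω i * (A i).indicator (fun _ => (1:ℝ)) ω) P := by
    refine integrable_finsetSum _ fun i _ => Integrable.mul_bdd (c := 1) ?_ ?_ ?_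
    · refine Integrable.of_bound ((measurable_pi_apply i).comp hw).aestronglyMeasurable 1
        (.of_forall fun ω => ?_)
      obtain ⟨h0, h1⟩ := hwsimplex ω
      rw [Real.norm_of_nonneg (h0 i), ← h1]
      exact Finset.single_le_sum (fun j _ => h0 j) (Finset.mem_univ i)
    · exact (measurable_const.indicator (hAmeas i)).aestronglyMeasurable
    · exact .of_forall fun ω => (norm_indicator_le_norm_self _ _).trans (by simp)
  set f : Ω → ℝ := fun ω => exp η * ∑ i, w ω i * (A i).indicator (fun _ => (1:ℝ)) ω + τ with hf
  have hf0 : 0 ≤ f := fun ω => add_nonneg (mul_nonneg (exp_pos η).le (Finset.sum_nonneg fun i _ =>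
    mul_nonneg ((hwsimplex ω).1 i) (Set.indicator_nonneg (fun _ _ => zero_le_one) ω))) hτ
  have hfint : Integrable f P := (hint.const_mul _).add (integrable_const _)
  have hfval : ∫ ω, f ω ∂P = exp η * β + τ := by
    rw [hf, integral_add (hint.const_mul _) (integrable_const _), integral_const_mul, ← hβ]
    simp
  have hmarkov := mul_meas_ge_le_integral_of_nonneg (.of_forall hf0) hfint (1 / 2)
  calc P {ω | (1:ℝ)/2 ≤ ∑ i, p ω i * (A i).indicator (fun _ => (1:ℝ)) ω}
      ≤ P {ω | 1 / 2 ≤ f ω} := measure_mono fun ω (hω : 1 / 2 ≤ _) =>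
        hω.trans (sum_mul_indicator_le_of_forall_finset A ω _ _ _ _ (hstab ω))
    _ = ENNReal.ofReal (P.real {ω | 1 / 2 ≤ f ω}) := (ofReal_measureReal).symm
    _ ≤ ENNReal.ofReal (2 * (β * exp η + τ)) := ENNReal.ofReal_le_ofReal (by linarith)
end

section
/- Tightness of the stable-selection coverage bound (Example: worst-case oracles). For every K ≥ 1 and every η, τ ≥ 0 with e^η/K + τ ≤ 1, there exist a probability space (Ω, ℱ, ℙ), events A_1, …, A_K with ℙ(A_i) = 1/K for every i, and a measurable map p : Ω → Δ^{K−1} satisfying the (η,τ)-stability bound with respect to the uniform prior b = (1/K, …, 1/K) — i.e., Σ_{i∈G} p_i(ω) ≤ e^η·|G|/K + τ for every ω ∈ Ω and every subset G ⊆ {1,…,K} — such that E[Σ_{i=1}^K p_i·1_{A_i}] = e^η/K + τ. Hence the upper bound α·e^η + τ of the stable-selection coverage theorem, with α = 1/K, is attained with equality. -/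
open MeasureTheory Real

/-- The vector with entry `m` at `j` whose remaining mass `1 - m` is spread evenly over the other
indices. -/
noncomputable def pointMassMixture (K : ℕ) (m : ℝ) (j i : Fin K) : ℝ :=
  if i = j then m else (1 - m) / ((K : ℝ) - 1)

theorem pointMassMixture_mem_stdSimplex {K : ℕ} {m : ℝ} (h0 : 0 ≤ m) (h1 : m ≤ 1)
    (hm : K = 1 → m = 1) (j : Fin K) : pointMassMixture K m j ∈ stdSimplex ℝ (Fin K) := by
  have hK : (1 : ℝ) ≤ K := by exact_mod_cast j.pos
  refine ⟨fun i => ?_, ?_⟩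
  · unfold pointMassMixture
    split_ifs
    · exact h0
    · exact div_nonneg (by linarith) (by linarith)
  · have hoff : ∑ i ∈ Finset.univ.erase j, pointMassMixture K m j i
        = ((K : ℝ) - 1) * ((1 - m) / ((K : ℝ) - 1)) := by
      have h (i) (hi : i ∈ Finset.univ.erase j) :
          pointMassMixture K m j i = (1 - m) / ((K : ℝ) - 1) :=
        if_neg (Finset.ne_of_mem_erase hi)
      rw [Finset.sum_congr rfl h]
      simp [Finset.card_erase_of_mem, Nat.cast_sub j.pos]
    rw [← Finset.add_sum_erase _ _ (Finset.mem_univ j), hoff, pointMassMixture, if_pos rfl]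
    rcases hK.eq_or_lt with h | h
    · rw [hm (by exact_mod_cast h.symm)]
      simp
    · have : (K : ℝ) - 1 ≠ 0 := by linarith
      field_simp
      ring

theorem pointMassMixture_le_inv {K : ℕ} {m : ℝ} (hm : 1 / (K : ℝ) ≤ m) {j i : Fin K}
    (hij : i ≠ j) : pointMassMixture K m j i ≤ 1 / K := by
  have hK : (1 : ℝ) < K := by
    have : (i : ℕ) ≠ j := Fin.val_ne_of_ne hij
    exact_mod_cast (by omega : 1 < K)
  rw [pointMassMixture, if_neg hij, div_le_iff₀ (by linarith)]
  have : 1 / (K : ℝ) * (K - 1) = 1 - 1 / K := by field_simp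
  linarith

/-- If every entry is at most `c`, except for one that may reach `c + t`, then a sum over `G` is at
most `c * #G + t`. -/
theorem sum_le_card_mul_add_of_le_ite {ι : Type*} [DecidableEq ι] {f : ι → ℝ} {c t : ℝ} {j : ι}
    (ht : 0 ≤ t) (hf : ∀ i, f i ≤ c + if i = j then t else 0) (G : Finset ι) :
    ∑ i ∈ G, f i ≤ G.card * c + t := by
  refine (Finset.sum_le_sum fun i _ => hf i).trans ?_
  rw [Finset.sum_add_distrib, Finset.sum_const, nsmul_eq_mul, Finset.sum_ite_eq']
  gcongr
  split_ifs <;> simp [ht]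

/-- **Tightness of the stable-selection coverage bound (worst-case oracles example).**
For every `K ≥ 1` and `η, τ ≥ 0` with `e^η/K + τ ≤ 1`, there exist a probability space,
events `A₁, …, A_K` each of probability exactly `1/K` (the miscoverage events of the
worst-case oracles), and a measurable selection distribution `p : Ω → Δ^{K-1}` satisfying
the `(η,τ)`-stability bound with respect to the uniform prior
(`∑_{i∈G} p i ≤ e^η·|G|/K + τ` for all `G`), whose post-selection miscoverage
`E[∑ i, p i · 1_{A i}]` equals exactly `e^η/K + τ`; hence the bound `α·e^η + τ` with
`α = 1/K` is attained with equality. -/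
theorem stable_selection_bound_tight
    (K : ℕ) (hK : 1 ≤ K) (η τ : ℝ) (hη : 0 ≤ η) (hτ : 0 ≤ τ)
    (hfeas : exp η / K + τ ≤ 1) :
    ∃ (Ω : Type) (mΩ : MeasurableSpace Ω) (P : Measure Ω),
      IsProbabilityMeasure P ∧
      ∃ (A : Fin K → Set Ω) (p : Ω → Fin K → ℝ),
        (∀ i, MeasurableSet (A i)) ∧
        Measurable p ∧
        (∀ i, P (A i) = ENNReal.ofReal (1 / K)) ∧
        (∀ ω, p ω ∈ stdSimplex ℝ (Fin K)) ∧
        (∀ ω, ∀ G : Finset (Fin K),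
          ∑ i ∈ G, p ω i ≤ exp η * ((G.card : ℝ) / K) + τ) ∧
        ∫ ω, (∑ i, p ω i * (A i).indicator (fun _ => (1:ℝ)) ω) ∂P = exp η / K + τ := by
  have : NeZero K := ⟨by omega⟩
  have hK1 : (1 : ℝ) ≤ K := by exact_mod_cast hK
  have hexp : 1 ≤ exp η := one_le_exp hη
  have hinv : 1 / (K : ℝ) ≤ exp η / K := by gcongr
  have hpos : 0 ≤ exp η / K := by positivity
  set m := exp η / K + τ with hm
  refine ⟨Fin K, ⊤, (PMF.uniformOfFintype (Fin K)).toMeasure, inferInstance,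
    fun i => {i}, pointMassMixture K m, fun i => trivial, measurable_from_top, fun i => ?_,
    pointMassMixture_mem_stdSimplex (by linarith) hfeas fun h => ?_, fun ω G => ?_, ?_⟩
  · rw [PMF.toMeasure_apply_singleton _ _ MeasurableSpace.measurableSet_top,
      PMF.uniformOfFintype_apply, Fintype.card_fin,
      one_div, ENNReal.ofReal_inv_of_pos (by linarith), ENNReal.ofReal_natCast]
  · refine le_antisymm hfeas ?_
    rw [h, Nat.cast_one, div_one] at hm
    linarith
  · have := sum_le_card_mul_add_of_le_ite (f := pointMassMixture K m ω) (c := exp η / K) (j := ω)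
      hτ (fun i => ?_) G
    · exact this.trans_eq (by ring)
    · split_ifs with h
      · rw [pointMassMixture, if_pos h]
      · linarith [pointMassMixture_le_inv (by linarith : 1 / (K : ℝ) ≤ m) h]
  · have hconst (ω : Fin K) : ∑ i, pointMassMixture K m ω i *
        ({i} : Set (Fin K)).indicator (fun _ => (1 : ℝ)) ω = m := by
      simp [Set.indicator_apply, pointMassMixture]
    simp only [hconst]
    simp
end
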